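/- Let F be a finite field and n ≥ 2. The subgroup of the symplectic group Sp(2n,F) generated by the set of its elements that differ from the 2n×2n identity matrix in at most one row is a proper subgroup of Sp(2n,F). Hence Sp(2n,F) is not internally computable for n ≥ 2. -/

import Mathlib

open Matrix

/-- A linear instruction: a square matrix over `F` that differs from the identity
matrix in at most one row. -/
def Matrix.IsLinearInstruction {m : Type*} [DecidableEq m] {F : Type*} [Semiring F]
    (M : Matrix m m F) : Prop :=
  ∃ i : m, ∀ j : m, j ≠ i → M j = (1 : Matrix m m F) j

/-- Multiplying by the transpose of a linear instruction leaves the columns other than the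
modified one unchanged. -/
theorem Matrix.mul_transpose_apply_of_row_eq_one {m R : Type*} [Fintype m] [DecidableEq m]
    [Semiring R] (A M : Matrix m m R) {z : m} (hz : M z = (1 : Matrix m m R) z) (x : m) :
    (A * Mᵀ) x z = A x z := by
  simp [Matrix.mul_apply, Matrix.transpose_apply, hz, Matrix.one_apply]

/-- A symplectic linear instruction has no entry linking two distinct hyperbolic planes. -/
theorem Matrix.IsLinearInstruction.apply_eq_zero_of_symplectic {l R : Type*} [Fintype l]
    [DecidableEq l] [CommRing R] {M : Matrix (l ⊕ l) (l ⊕ l) R} (hM : M.IsLinearInstruction)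
    (hJ : M * Matrix.fromBlocks 0 1 (-1) 0 * Mᵀ = Matrix.fromBlocks 0 1 (-1) 0)
    {x y : l ⊕ l} (hxy : Sum.elim id id x ≠ Sum.elim id id y) : M x y = 0 := by
  obtain ⟨i, hi⟩ := hM
  by_cases hx : x = i
  · subst hx
    have hswap : y.swap ≠ x := by
      rintro rfl
      cases y <;> simp at hxy
    have h := congrFun (congrFun hJ x) y.swap
    rw [Matrix.mul_transpose_apply_of_row_eq_one _ _ (hi _ hswap)] at h
    rcases x with a | a <;> rcases y with b | b <;>
      simpa [Matrix.mul_apply, Matrix.one_apply, Fintype.sum_sum_type, Matrix.neg_apply,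
        show a ≠ b from hxy] using h
  · rw [hi x hx, Matrix.one_apply_ne]
    rintro rfl
    exact hxy rfl

/-- A symplectic linear instruction commutes with every diagonal matrix that is constant on
hyperbolic planes. -/
theorem Matrix.IsLinearInstruction.commute_diagonal_of_symplectic {l R : Type*} [Fintype l]
    [DecidableEq l] [CommRing R] {M : Matrix (l ⊕ l) (l ⊕ l) R} (hM : M.IsLinearInstruction)
    (hJ : M * Matrix.fromBlocks 0 1 (-1) 0 * Mᵀ = Matrix.fromBlocks 0 1 (-1) 0) (d : l → R) :
    Commute M (Matrix.diagonal fun x => d (Sum.elim id id x)) := by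
  ext x y
  rw [Matrix.mul_diagonal, Matrix.diagonal_mul]
  by_cases hxy : Sum.elim id id x = Sum.elim id id y
  · rw [hxy, mul_comm]
  · simp [hM.apply_eq_zero_of_symplectic hJ hxy]

/-- For `n ≥ 2`, the symplectic group `Sp(2n, F)` (with respect to
`J = [[0, I], [-I, 0]]`) is not internally computable: the subgroup generated by the
symplectic matrices that are linear instructions is a proper subgroup, i.e. some
symplectic matrix does not belong to it. -/
theorem symplectic_group_not_internally_computable
    (F : Type*) [Field F] [Fintype F] (n : ℕ) (hn : 2 ≤ n) :
    ∃ M : Matrix.GeneralLinearGroup (Fin n ⊕ Fin n) F,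
      (M : Matrix (Fin n ⊕ Fin n) (Fin n ⊕ Fin n) F) * Matrix.fromBlocks 0 1 (-1) 0 *
          (M : Matrix (Fin n ⊕ Fin n) (Fin n ⊕ Fin n) F)ᵀ = Matrix.fromBlocks 0 1 (-1) 0 ∧
      M ∉ Subgroup.closure {g : Matrix.GeneralLinearGroup (Fin n ⊕ Fin n) F |
        (g : Matrix (Fin n ⊕ Fin n) (Fin n ⊕ Fin n) F) * Matrix.fromBlocks 0 1 (-1) 0 *
            (g : Matrix (Fin n ⊕ Fin n) (Fin n ⊕ Fin n) F)ᵀ = Matrix.fromBlocks 0 1 (-1) 0 ∧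
        Matrix.IsLinearInstruction (g : Matrix (Fin n ⊕ Fin n) (Fin n ⊕ Fin n) F)} := by
  let S : Matrix (Fin n) (Fin n) F := Matrix.of fun _ _ => 1
  have hS : Sᵀ = S := rfl
  refine ⟨⟨Matrix.fromBlocks 1 S 0 1, Matrix.fromBlocks 1 (-S) 0 1, ?_, ?_⟩, ?_, ?_⟩
  · simp [Matrix.fromBlocks_multiply]
  · simp [Matrix.fromBlocks_multiply]
  · simp [Matrix.fromBlocks_multiply, Matrix.fromBlocks_transpose, hS]
  · intro hmem
    let d : Fin n → F := Pi.single ⟨0, by omega⟩ 1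
    have hcomm : ∀ g ∈ Subgroup.closure {g : Matrix.GeneralLinearGroup (Fin n ⊕ Fin n) F |
        (g : Matrix (Fin n ⊕ Fin n) (Fin n ⊕ Fin n) F) * Matrix.fromBlocks 0 1 (-1) 0 *
            (g : Matrix (Fin n ⊕ Fin n) (Fin n ⊕ Fin n) F)ᵀ = Matrix.fromBlocks 0 1 (-1) 0 ∧
        Matrix.IsLinearInstruction (g : Matrix (Fin n ⊕ Fin n) (Fin n ⊕ Fin n) F)},
        Commute (g : Matrix (Fin n ⊕ Fin n) (Fin n ⊕ Fin n) F)
          (Matrix.diagonal fun x => d (Sum.elim id id x)) := by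
      intro g hg
      induction hg using Subgroup.closure_induction with
      | mem g hg => exact hg.2.commute_diagonal_of_symplectic hg.1 d
      | one => exact Commute.one_left _
      | mul g h _ _ hg hh => exact hg.mul_left hh
      | inv g _ hg => exact hg.units_inv_left
    have h := congrFun (congrFun (hcomm _ hmem).eq (Sum.inl ⟨0, by omega⟩))
      (Sum.inr ⟨1, by omega⟩)
    rw [Matrix.mul_diagonal, Matrix.diagonal_mul] at h
    simp [S, d] at h
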